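/- arXiv:2512.14159 — 3 statements merged into one kernel-verified Lean document; each statement's English description precedes it below -/
import Mathlib

section
/- Let τ : ℂ⁴ → ℂ be entire, nowhere zero, and satisfy (E1) and (E2) of the variant bilinear Blaszak–Szum system. Define u(n) = τ(n+i)τ(n−i)/τ(n)², v(n) = (τ_tt(n+i/2)·τ(n−i/2) − 2τ_t(n+i/2)·τ_t(n−i/2) + τ(n+i/2)·τ_tt(n−i/2)) / (τ(n+i/2)·τ(n−i/2)), and w(n) = i·(τ_t(n+i/2)/τ(n+i/2) − τ_t(n−i/2)/τ(n−i/2)). Then for all (n,t,y,z) ∈ ℂ⁴: (a) ∂_t u(n) = i·u(n)·(w(n−i/2) − w(n+i/2)); (b) ∂_t v(n) = i·u(n+i/2) − i·u(n−i/2) − ∂_y w(n); and (c) ∂_t w(n+i/2) + ∂_t w(n−i/2) = i·( v(n+i/2) − v(n−i/2) + w(n+i/2)² − w(n−i/2)² ). That is, (u, v, w) solves the variant Blaszak–Szum lattice equation. -/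
/-- Partial derivative in the second ("t") variable. -/
noncomputable def dT (f : ℂ → ℂ → ℂ → ℂ → ℂ) : ℂ → ℂ → ℂ → ℂ → ℂ :=
  fun n t y z => deriv (fun s => f n s y z) t

/-- Partial derivative in the third ("y") variable. -/
noncomputable def dY (f : ℂ → ℂ → ℂ → ℂ → ℂ) : ℂ → ℂ → ℂ → ℂ → ℂ :=
  fun n t y z => deriv (fun s => f n t s z) y

/-- Partial derivative in the fourth ("z") variable. -/
noncomputable def dZ (f : ℂ → ℂ → ℂ → ℂ → ℂ) : ℂ → ℂ → ℂ → ℂ → ℂ :=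
  fun n t y z => deriv (fun s => f n t y s) z

/-- Entire function of four complex variables. -/
def Entire4 (f : ℂ → ℂ → ℂ → ℂ → ℂ) : Prop :=
  Differentiable ℂ (fun p : ℂ × ℂ × ℂ × ℂ => f p.1 p.2.1 p.2.2.1 p.2.2.2)

/-- The variant bilinear Blaszak–Szum system: equations (E1) and (E2) in shift form. -/
def VariantBS (τ : ℂ → ℂ → ℂ → ℂ → ℂ) : Prop :=
  ∀ n t y z : ℂ,
    ((-Complex.I) * (dZ τ (n + Complex.I) t y z * τ n t y z
        - τ (n + Complex.I) t y z * dZ τ n t y z)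
      = dT (dT τ) (n + Complex.I) t y z * τ n t y z
        - 2 * dT τ (n + Complex.I) t y z * dT τ n t y z
        + τ (n + Complex.I) t y z * dT (dT τ) n t y z)
    ∧ ((dT (dZ τ) n t y z - dT (dY τ) n t y z) * τ n t y z
        - dT τ n t y z * (dZ τ n t y z - dY τ n t y z)
      = τ n t y z ^ 2 - τ (n + Complex.I) t y z * τ (n - Complex.I) t y z)

open Filter Topology Set

/-- If `G` is jointly continuous and holomorphic in its second variable, then its derivative in
the second variable is jointly continuous. -/
theorem continuous_deriv_of_continuous_uncurry {G : ℂ → ℂ → ℂ}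
    (hG : Continuous fun p : ℂ × ℂ => G p.1 p.2) (hx : ∀ s, Differentiable ℂ (G s)) :
    Continuous fun p : ℂ × ℂ => deriv (G p.1) p.2 := by
  rw [continuous_iff_continuousAt]
  rintro ⟨s₀, x₀⟩
  have hlim : TendstoLocallyUniformlyOn G (G s₀) (𝓝 s₀) univ := by
    intro V hV x _
    obtain ⟨W, hW, hWsymm, hWV⟩ := comp_symm_mem_uniformity_sets hV
    have hs : ∀ᶠ p : ℂ × ℂ in 𝓝 s₀ ×ˢ 𝓝 x, (G s₀ x, G p.1 p.2) ∈ W := by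
      rw [← nhds_prod_eq]
      exact hG.continuousAt (x := (s₀, x)) (mem_nhds_left _ hW)
    have hs₀ : ∀ᶠ y in 𝓝 x, (G s₀ x, G s₀ y) ∈ W :=
      (hx s₀).continuous.continuousAt (mem_nhds_left _ hW)
    obtain ⟨A, hA, B, hB, hAB⟩ := eventually_prod_iff.1 hs
    refine ⟨{y | B y ∧ (G s₀ x, G s₀ y) ∈ W}, ?_, ?_⟩
    · rw [nhdsWithin_univ]
      exact hB.and hs₀
    · filter_upwards [hA] with s hsA y hy
      exact hWV ⟨G s₀ x, hWsymm.symm _ _ hy.2, hAB hsA hy.1⟩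
  have hderiv := hlim.deriv (Eventually.of_forall fun s => (hx s).differentiableOn) isOpen_univ
  have hcont : ContinuousAt (deriv (G s₀)) x₀ := (hx s₀).deriv.continuous.continuousAt
  rw [ContinuousAt, Metric.tendsto_nhds]
  intro ε hε
  obtain ⟨B, hB, hclose⟩ :=
    hderiv _ (Metric.dist_mem_uniformity (half_pos hε)) x₀ (mem_univ _)
  rw [nhdsWithin_univ] at hB
  rw [nhds_prod_eq]
  filter_upwards [hclose.prod_mk (Filter.inter_mem hB
    (Metric.tendsto_nhds.1 hcont _ (half_pos hε)))] with p hp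
  have h₁ : dist (deriv (G s₀) p.2) (deriv (G p.1) p.2) < ε / 2 := hp.1 p.2 hp.2.1
  have h₂ : dist (deriv (G s₀) p.2) (deriv (G s₀) x₀) < ε / 2 := hp.2.2
  have h₃ := dist_triangle_left (deriv (G p.1) p.2) (deriv (G s₀) x₀) (deriv (G s₀) p.2)
  exact h₃.trans_lt (by linarith)

/-- The difference quotients in the second variable converge locally uniformly in the first. -/
theorem tendstoLocallyUniformlyOn_slope {G : ℂ → ℂ → ℂ}
    (hG : Continuous fun p : ℂ × ℂ => G p.1 p.2) (hx : ∀ s, Differentiable ℂ (G s)) (x₀ : ℂ) :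
    TendstoLocallyUniformlyOn (fun h s => h⁻¹ * (G s (x₀ + h) - G s x₀))
      (fun s => deriv (G s) x₀) (𝓝[≠] 0) univ := by
  rw [Metric.tendstoLocallyUniformlyOn_iff]
  intro ε hε s₀ _
  obtain ⟨δ, hδ, hball⟩ := Metric.continuousAt_iff.1
    ((continuous_deriv_of_continuous_uncurry hG hx).continuousAt (x := (s₀, x₀))) (ε / 4)
    (by positivity)
  refine ⟨Metric.ball s₀ δ, mem_nhdsWithin_of_mem_nhds (Metric.ball_mem_nhds _ hδ), ?_⟩
  filter_upwards [self_mem_nhdsWithin,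
    mem_nhdsWithin_of_mem_nhds (Metric.ball_mem_nhds (0 : ℂ) hδ)] with h hne hh s hs
  have hne : h ≠ 0 := hne
  have hxh : x₀ + h ∈ Metric.ball x₀ δ := by simpa [dist_eq_norm] using hh
  have hnear : ∀ x ∈ Metric.ball x₀ δ, ‖deriv (G s) x - deriv (G s) x₀‖ ≤ ε / 2 := by
    intro x hx'
    have h₁ := hball (x := (s, x)) (by
      rw [Prod.dist_eq]; exact max_lt hs hx')
    have h₂ := hball (x := (s, x₀)) (by
      rw [Prod.dist_eq]; exact max_lt hs (by simpa using hδ))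
    have h₃ := dist_triangle_right (deriv (G s) x) (deriv (G s) x₀) (deriv (G s₀) x₀)
    rw [← dist_eq_norm]
    exact h₃.trans (by linarith)
  have hmv := (convex_ball x₀ δ).norm_image_sub_le_of_norm_hasDerivWithin_le
    (f := fun x => G s x - deriv (G s) x₀ * x)
    (fun x _ => ((hx s x).hasDerivAt.sub
      ((hasDerivAt_id x).const_mul (deriv (G s) x₀))).hasDerivWithinAt)
    (C := ε / 2) (fun x hx' => by simpa using hnear x hx')
    (Metric.mem_ball_self hδ) hxh
  have hrw : deriv (G s) x₀ - h⁻¹ * (G s (x₀ + h) - G s x₀)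
      = -(h⁻¹ * (G s (x₀ + h) - deriv (G s) x₀ * (x₀ + h)
        - (G s x₀ - deriv (G s) x₀ * x₀))) := by
    field_simp
    ring
  rw [dist_eq_norm, hrw, norm_neg, norm_mul, norm_inv]
  have hpos : 0 < ‖h‖ := norm_pos_iff.2 hne
  rw [add_sub_cancel_left] at hmv
  calc ‖h‖⁻¹ * _ ≤ ‖h‖⁻¹ * (ε / 2 * ‖h‖) := by gcongr
    _ = ε / 2 := by field_simp
    _ < ε := half_lt_self hε

/-- The partial derivative of a holomorphic function of two variables in the second variable is
holomorphic in the first, and the mixed partial derivatives agree. -/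
theorem differentiable_deriv_and_hasDerivAt_deriv {G : ℂ → ℂ → ℂ}
    (hG : Differentiable ℂ fun p : ℂ × ℂ => G p.1 p.2) (x₀ : ℂ) :
    (Differentiable ℂ fun s => deriv (G s) x₀) ∧
      ∀ s₀, HasDerivAt (fun x => deriv (fun s => G s x) s₀)
        (deriv (fun s => deriv (G s) x₀) s₀) x₀ := by
  have hx : ∀ s, Differentiable ℂ (G s) := fun s =>
    hG.comp ((differentiable_const s).prodMk differentiable_id)
  have hs : ∀ x, Differentiable ℂ fun s => G s x := fun x =>
    hG.comp (differentiable_id.prodMk (differentiable_const x))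
  have hlim := tendstoLocallyUniformlyOn_slope hG.continuous hx x₀
  have hquot : ∀ h : ℂ, Differentiable ℂ fun s => h⁻¹ * (G s (x₀ + h) - G s x₀) := fun h =>
    ((hs _).sub (hs _)).const_mul _
  have hev : ∀ᶠ h : ℂ in 𝓝[≠] 0,
      DifferentiableOn ℂ (fun s => h⁻¹ * (G s (x₀ + h) - G s x₀)) univ :=
    Eventually.of_forall fun h => (hquot h).differentiableOn
  refine ⟨differentiableOn_univ.1 (hlim.differentiableOn hev isOpen_univ), fun s₀ => ?_⟩
  rw [hasDerivAt_iff_tendsto_slope_zero]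
  refine ((hlim.deriv hev isOpen_univ).tendsto_at (mem_univ s₀)).congr fun h => ?_
  exact (((hs (x₀ + h) s₀).hasDerivAt.sub (hs x₀ s₀).hasDerivAt).const_mul h⁻¹).deriv

namespace Entire4

variable {τ : ℂ → ℂ → ℂ → ℂ → ℂ}

theorem hasDerivAt_t (hτ : Entire4 τ) (n t y z : ℂ) :
    HasDerivAt (fun s => τ n s y z) (dT τ n t y z) t :=
  (hτ.comp (f := fun s : ℂ => (n, s, y, z)) (by fun_prop) t).hasDerivAt

theorem hasDerivAt_dT_t (hτ : Entire4 τ) (n t y z : ℂ) :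
    HasDerivAt (fun s => dT τ n s y z) (dT (dT τ) n t y z) t :=
  ((hτ.comp (f := fun s : ℂ => (n, s, y, z)) (by fun_prop)).deriv t).hasDerivAt

theorem hasDerivAt_y (hτ : Entire4 τ) (n t y z : ℂ) :
    HasDerivAt (fun s => τ n t s z) (dY τ n t y z) y :=
  (hτ.comp (f := fun s : ℂ => (n, t, s, z)) (by fun_prop) y).hasDerivAt

theorem hasDerivAt_dZ_t (hτ : Entire4 τ) (n t y z : ℂ) :
    HasDerivAt (fun s => dZ τ n s y z) (dT (dZ τ) n t y z) t :=
  ((differentiable_deriv_and_hasDerivAt_deriv (G := fun s x => τ n s y x)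
    (hτ.comp (f := fun p : ℂ × ℂ => (n, p.1, y, p.2)) (by fun_prop)) z).1 t).hasDerivAt

theorem hasDerivAt_dT_y (hτ : Entire4 τ) (n t y z : ℂ) :
    HasDerivAt (fun s => dT τ n t s z) (dT (dY τ) n t y z) y :=
  (differentiable_deriv_and_hasDerivAt_deriv (G := fun s x => τ n s x z)
    (hτ.comp (f := fun p : ℂ × ℂ => (n, p.1, p.2, z)) (by fun_prop)) y).2 t

end Entire4

/-- if the entire nowhere-zero `τ` solves the variant bilinear BS system, then
`u = τ(n+i)τ(n−i)/τ(n)²`, `v = D_t²τ(n+i/2)·τ(n−i/2)/(τ(n+i/2)τ(n−i/2))`,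
`w = i∂_t ln(τ(n+i/2)/τ(n−i/2))` solve the variant Blaszak–Szum lattice equation in its
complex-shift form (a)–(c). -/
theorem variantBS_lattice_from_bilinear (τ : ℂ → ℂ → ℂ → ℂ → ℂ)
    (hτe : Entire4 τ) (hτ0 : ∀ n t y z, τ n t y z ≠ 0) (hBS : VariantBS τ)
    (u v w : ℂ → ℂ → ℂ → ℂ → ℂ)
    (hu : ∀ n t y z, u n t y z
      = τ (n + Complex.I) t y z * τ (n - Complex.I) t y z / (τ n t y z) ^ 2)
    (hv : ∀ n t y z, v n t y z
      = (dT (dT τ) (n + Complex.I / 2) t y z * τ (n - Complex.I / 2) t y z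
          - 2 * dT τ (n + Complex.I / 2) t y z * dT τ (n - Complex.I / 2) t y z
          + τ (n + Complex.I / 2) t y z * dT (dT τ) (n - Complex.I / 2) t y z)
        / (τ (n + Complex.I / 2) t y z * τ (n - Complex.I / 2) t y z))
    (hw : ∀ n t y z, w n t y z
      = Complex.I * (dT τ (n + Complex.I / 2) t y z / τ (n + Complex.I / 2) t y z
          - dT τ (n - Complex.I / 2) t y z / τ (n - Complex.I / 2) t y z)) :
    ∀ n t y z : ℂ,
      (dT u n t y z
        = Complex.I * u n t y z
            * (w (n - Complex.I / 2) t y z - w (n + Complex.I / 2) t y z))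
      ∧ (dT v n t y z
        = Complex.I * u (n + Complex.I / 2) t y z - Complex.I * u (n - Complex.I / 2) t y z
            - dY w n t y z)
      ∧ (dT w (n + Complex.I / 2) t y z + dT w (n - Complex.I / 2) t y z
        = Complex.I * (v (n + Complex.I / 2) t y z - v (n - Complex.I / 2) t y z
            + (w (n + Complex.I / 2) t y z) ^ 2 - (w (n - Complex.I / 2) t y z) ^ 2)) := by
  have hu' : u = fun n t y z =>
      τ (n + Complex.I) t y z * τ (n - Complex.I) t y z / (τ n t y z) ^ 2 := by
    funext n t y z; exact hu n t y z
  have hw' : w = fun n t y z =>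
      Complex.I * (dT τ (n + Complex.I / 2) t y z / τ (n + Complex.I / 2) t y z
        - dT τ (n - Complex.I / 2) t y z / τ (n - Complex.I / 2) t y z) := by
    funext n t y z; exact hw n t y z
  have hvZ : v = fun n t y z =>
      -Complex.I * (dZ τ (n + Complex.I / 2) t y z / τ (n + Complex.I / 2) t y z
        - dZ τ (n - Complex.I / 2) t y z / τ (n - Complex.I / 2) t y z) := by
    funext n t y z
    have h := (hBS (n - Complex.I / 2) t y z).1
    rw [show n - Complex.I / 2 + Complex.I = n + Complex.I / 2 by ring] at h
    have h₁ := hτ0 (n + Complex.I / 2) t y z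
    have h₂ := hτ0 (n - Complex.I / 2) t y z
    rw [hv, ← h]
    generalize n + Complex.I / 2 = a, n - Complex.I / 2 = b at *
    field_simp
  have hwT : ∀ n t y z, dT w n t y z = Complex.I *
      ((dT (dT τ) (n + Complex.I / 2) t y z * τ (n + Complex.I / 2) t y z
          - dT τ (n + Complex.I / 2) t y z * dT τ (n + Complex.I / 2) t y z)
          / τ (n + Complex.I / 2) t y z ^ 2
        - (dT (dT τ) (n - Complex.I / 2) t y z * τ (n - Complex.I / 2) t y z
          - dT τ (n - Complex.I / 2) t y z * dT τ (n - Complex.I / 2) t y z)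
          / τ (n - Complex.I / 2) t y z ^ 2) := by
    intro n t y z
    rw [hw']
    exact ((((hτe.hasDerivAt_dT_t _ t y z).div (hτe.hasDerivAt_t _ t y z) (hτ0 _ _ _ _)).sub
      ((hτe.hasDerivAt_dT_t _ t y z).div (hτe.hasDerivAt_t _ t y z)
        (hτ0 _ _ _ _))).const_mul _).deriv
  have hE2 : ∀ n t y z,
      (dT (dZ τ) n t y z * τ n t y z - dZ τ n t y z * dT τ n t y z) / τ n t y z ^ 2
        = 1 - u n t y z
          + (dT (dY τ) n t y z * τ n t y z - dT τ n t y z * dY τ n t y z) / τ n t y z ^ 2 := by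
    intro n t y z
    have h := (hBS n t y z).2
    have h₀ := hτ0 n t y z
    rw [hu]
    field_simp
    linear_combination h
  intro n t y z
  refine ⟨?_, ?_, ?_⟩
  · have hder : dT u n t y z = _ :=
      (congrArg (fun f => dT f n t y z) hu').trans
        (((hτe.hasDerivAt_t (n + Complex.I) t y z).mul
          (hτe.hasDerivAt_t (n - Complex.I) t y z)).div
          ((hτe.hasDerivAt_t n t y z).pow 2) (pow_ne_zero 2 (hτ0 n t y z))).deriv
    rw [hder, hu, hw, hw, sub_add_cancel, add_sub_cancel_right,
      show n - Complex.I / 2 - Complex.I / 2 = n - Complex.I by ring,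
      show n + Complex.I / 2 + Complex.I / 2 = n + Complex.I by ring]
    have h₀ := hτ0 n t y z
    have h₁ := hτ0 (n + Complex.I) t y z
    have h₂ := hτ0 (n - Complex.I) t y z
    simp only [Pi.mul_apply, Pi.pow_apply]
    field_simp
    rw [Complex.I_sq]
    ring
  · have hvT : dT v n t y z = _ :=
      (congrArg (fun f => dT f n t y z) hvZ).trans
        ((((hτe.hasDerivAt_dZ_t (n + Complex.I / 2) t y z).div
            (hτe.hasDerivAt_t _ t y z) (hτ0 _ _ _ _)).sub
          ((hτe.hasDerivAt_dZ_t (n - Complex.I / 2) t y z).div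
            (hτe.hasDerivAt_t _ t y z) (hτ0 _ _ _ _))).const_mul _).deriv
    have hwY : dY w n t y z = _ :=
      (congrArg (fun f => dY f n t y z) hw').trans
        ((((hτe.hasDerivAt_dT_y (n + Complex.I / 2) t y z).div
            (hτe.hasDerivAt_y _ t y z) (hτ0 _ _ _ _)).sub
          ((hτe.hasDerivAt_dT_y (n - Complex.I / 2) t y z).div
            (hτe.hasDerivAt_y _ t y z) (hτ0 _ _ _ _))).const_mul _).deriv
    rw [hvT, hwY, hE2, hE2]
    ring
  · rw [hwT, hwT, hv, hv, hw, hw, sub_add_cancel, add_sub_cancel_right,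
      show n - Complex.I / 2 - Complex.I / 2 = n - Complex.I by ring,
      show n + Complex.I / 2 + Complex.I / 2 = n + Complex.I by ring]
    have h₀ := hτ0 n t y z
    have h₁ := hτ0 (n + Complex.I) t y z
    have h₂ := hτ0 (n - Complex.I) t y z
    simp only [mul_pow, Complex.I_sq]
    field_simp
    ring
end

section
/- Let α₁, α₂ ∈ ℝ with α₁ ≠ α₂ and β₁ = β₂ = β > 0. With ζ̃₁, ζ̃₂, ζ̃₃ and τ the breather phases and tau function defined in the context (extended to complex n), set T = 2π/|α₂ − α₁|. Then τ(n, t+T, y) = e^{2βT}·τ(n, t, y) for all complex n and real t, y; consequently the breather solution u(n,t,y) = τ(n+i,t,y)·τ(n−i,t,y)/τ(n,t,y)² satisfies u(n, t+T, y) = u(n, t, y) wherever it is defined, i.e. the Kuznetsov–Ma breather is periodic in t with period 2π/|α₂ − α₁|. -/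
/-- the Kuznetsov–Ma breather (α₁ ≠ α₂, β₁ = β₂ = β > 0) is periodic in `t` with
period `T = 2π/|α₂ − α₁|`: the tau function scales by `e^{2βT}` under `t ↦ t + T`, hence the
solution `u = τ(n+i)τ(n−i)/τ(n)²` is `T`-periodic in `t`. -/
theorem kuznetsov_ma_breather_periodic (α1 α2 β : ℝ) (hα : α1 ≠ α2) (hβ : 0 < β)
    (ζ1 ζ2 ζ3 : ℂ → ℝ → ℝ → ℂ)
    (hζ1 : ∀ (n : ℂ) (t y : ℝ), ζ1 n t y
      = ((Complex.arg ((α1 : ℂ) + (β : ℂ) * Complex.I) : ℝ) : ℂ) * n + (β : ℂ) * (t : ℂ)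
        + ((-β / (α1 ^ 2 + β ^ 2) + 2 * α1 * β : ℝ) : ℂ) * (y : ℂ))
    (hζ2 : ∀ (n : ℂ) (t y : ℝ), ζ2 n t y
      = ((Complex.arg ((α2 : ℂ) + (β : ℂ) * Complex.I) : ℝ) : ℂ) * n + (β : ℂ) * (t : ℂ)
        + ((-β / (α2 ^ 2 + β ^ 2) + 2 * α2 * β : ℝ) : ℂ) * (y : ℂ))
    (hζ3 : ∀ (n : ℂ) (t y : ℝ), ζ3 n t y
      = ((1 / 2 * (Real.log (α2 ^ 2 + β ^ 2) - Real.log (α1 ^ 2 + β ^ 2)) : ℝ) : ℂ) * n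
        + ((α2 - α1 : ℝ) : ℂ) * (t : ℂ)
        + ((-α1 / (α1 ^ 2 + β ^ 2) + α2 / (α2 ^ 2 + β ^ 2)
            + α2 ^ 2 - β ^ 2 - α1 ^ 2 + β ^ 2 : ℝ) : ℂ) * (y : ℂ))
    (tau : ℂ → ℝ → ℝ → ℂ)
    (htau : ∀ (n : ℂ) (t y : ℝ), tau n t y
      = Complex.exp (2 * ζ1 n t y) / (2 * (β : ℂ))
        + Complex.exp (2 * ζ2 n t y) / (2 * (β : ℂ))
        + 2 * ((β : ℂ) + (β : ℂ)) * Complex.exp (ζ1 n t y + ζ2 n t y)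
            * Complex.cos (ζ3 n t y) / (((β + β) ^ 2 + (α1 - α2) ^ 2 : ℝ) : ℂ)
        + 2 * ((α2 - α1 : ℝ) : ℂ) * Complex.exp (ζ1 n t y + ζ2 n t y)
            * Complex.sin (ζ3 n t y) / (((β + β) ^ 2 + (α1 - α2) ^ 2 : ℝ) : ℂ))
    (T : ℝ) (hT : T = 2 * Real.pi / |α2 - α1|) :
    (∀ (n : ℂ) (t y : ℝ), tau n (t + T) y
      = ((Real.exp (2 * β * T) : ℝ) : ℂ) * tau n t y)
    ∧ (∀ (n : ℂ) (t y : ℝ),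
        tau (n + Complex.I) (t + T) y * tau (n - Complex.I) (t + T) y
            / (tau n (t + T) y) ^ 2
          = tau (n + Complex.I) t y * tau (n - Complex.I) t y / (tau n t y) ^ 2) := by
  have hne : α2 - α1 ≠ 0 := sub_ne_zero.mpr hα.symm
  have hphase : (α2 - α1) * T = 2 * Real.pi ∨ (α2 - α1) * T = -(2 * Real.pi) := by
    rcases abs_choice (α2 - α1) with h | h <;> rw [hT, h]
    · left
      field_simp
    · right
      field_simp
  have shift1 (n : ℂ) (t y : ℝ) : ζ1 n (t + T) y = ζ1 n t y + β * T := by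
    rw [hζ1, hζ1, Complex.ofReal_add t T]
    ring
  have shift2 (n : ℂ) (t y : ℝ) : ζ2 n (t + T) y = ζ2 n t y + β * T := by
    rw [hζ2, hζ2, Complex.ofReal_add t T]
    ring
  have shift3 (n : ℂ) (t y : ℝ) :
      ζ3 n (t + T) y = ζ3 n t y + (((α2 - α1) * T : ℝ) : ℂ) := by
    rw [hζ3, hζ3, Complex.ofReal_add t T, Complex.ofReal_mul (α2 - α1) T]
    ring
  have hcos (n : ℂ) (t y : ℝ) : Complex.cos (ζ3 n (t + T) y) = Complex.cos (ζ3 n t y) := by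
    rw [shift3]
    rcases hphase with h | h <;> rw [h] <;> push_cast
    · exact Complex.cos_add_two_pi _
    · rw [← sub_eq_add_neg, Complex.cos_sub_two_pi]
  have hsin (n : ℂ) (t y : ℝ) : Complex.sin (ζ3 n (t + T) y) = Complex.sin (ζ3 n t y) := by
    rw [shift3]
    rcases hphase with h | h <;> rw [h] <;> push_cast
    · exact Complex.sin_add_two_pi _
    · rw [← sub_eq_add_neg, Complex.sin_sub_two_pi]
  have hscale (n : ℂ) (t y : ℝ) :
      tau n (t + T) y = ((Real.exp (2 * β * T) : ℝ) : ℂ) * tau n t y := by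
    have hexp (a b : ℂ) : Complex.exp (a + β * T + (b + β * T))
        = ((Real.exp (2 * β * T) : ℝ) : ℂ) * Complex.exp (a + b) := by
      push_cast
      rw [← Complex.exp_add]
      ring_nf
    rw [htau, htau, hcos, hsin, shift1, shift2, hexp, two_mul (ζ1 n t y + _), hexp,
      two_mul (ζ2 n t y + _), hexp, two_mul (ζ1 n t y), two_mul (ζ2 n t y)]
    ring
  refine ⟨hscale, fun n t y => ?_⟩
  have hE : ((Real.exp (2 * β * T) : ℝ) : ℂ) ≠ 0 :=
    Complex.ofReal_ne_zero.mpr (Real.exp_ne_zero _)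
  rw [hscale, hscale, hscale, mul_mul_mul_comm, mul_pow, ← sq,
    mul_div_mul_left _ _ (pow_ne_zero 2 hE)]
end

section
/- Let α₁ = α₂ = α ∈ ℝ and β₁, β₂ > 0 with β₁ ≠ β₂, and suppose the y-coefficients of ζ̃₁ and ζ̃₂ coincide, i.e. −β₁/(α²+β₁²) + 2αβ₁ = −β₂/(α²+β₂²) + 2αβ₂ =: κ, and that the y-coefficient κ₃ = −α/(α²+β₁²) + α/(α²+β₂²) + β₁² − β₂² of ζ̃₃ is nonzero. With ζ̃₁, ζ̃₂, ζ̃₃ and τ the breather phases and tau function defined in the context (extended to complex n), set T = 2π/|κ₃|. Then τ(n, t, y+T) = e^{2κT}·τ(n, t, y) for all complex n and real t, y; consequently the breather solution u(n,t,y) = τ(n+i,t,y)·τ(n−i,t,y)/τ(n,t,y)² satisfies u(n, t, y+T) = u(n, t, y) wherever it is defined, i.e. the Akhmediev breather is periodic in y with period 2π/|κ₃|. -/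
/-- the Akhmediev breather (α₁ = α₂ = α, β₁ ≠ β₂ > 0, equal `y`-coefficients
`κ` of `ζ̃₁`, `ζ̃₂`, and nonzero `y`-coefficient `κ₃` of `ζ̃₃`) is periodic in `y` with period
`T = 2π/|κ₃|`: the tau function scales by `e^{2κT}` under `y ↦ y + T`, hence the solution
`u = τ(n+i)τ(n−i)/τ(n)²` is `T`-periodic in `y`. -/
theorem akhmediev_breather_periodic (α β1 β2 : ℝ) (hβ1 : 0 < β1) (hβ2 : 0 < β2)
    (hββ : β1 ≠ β2) (κ κ3 : ℝ)
    (hκ1 : κ = -β1 / (α ^ 2 + β1 ^ 2) + 2 * α * β1)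
    (hκ2 : κ = -β2 / (α ^ 2 + β2 ^ 2) + 2 * α * β2)
    (hκ3 : κ3 = -α / (α ^ 2 + β1 ^ 2) + α / (α ^ 2 + β2 ^ 2) + β1 ^ 2 - β2 ^ 2)
    (hκ3ne : κ3 ≠ 0)
    (ζ1 ζ2 ζ3 : ℂ → ℝ → ℝ → ℂ)
    (hζ1 : ∀ (n : ℂ) (t y : ℝ), ζ1 n t y
      = ((Complex.arg ((α : ℂ) + (β1 : ℂ) * Complex.I) : ℝ) : ℂ) * n + (β1 : ℂ) * (t : ℂ)
        + ((-β1 / (α ^ 2 + β1 ^ 2) + 2 * α * β1 : ℝ) : ℂ) * (y : ℂ))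
    (hζ2 : ∀ (n : ℂ) (t y : ℝ), ζ2 n t y
      = ((Complex.arg ((α : ℂ) + (β2 : ℂ) * Complex.I) : ℝ) : ℂ) * n + (β2 : ℂ) * (t : ℂ)
        + ((-β2 / (α ^ 2 + β2 ^ 2) + 2 * α * β2 : ℝ) : ℂ) * (y : ℂ))
    (hζ3 : ∀ (n : ℂ) (t y : ℝ), ζ3 n t y
      = ((1 / 2 * (Real.log (α ^ 2 + β2 ^ 2) - Real.log (α ^ 2 + β1 ^ 2)) : ℝ) : ℂ) * n
        + ((α - α : ℝ) : ℂ) * (t : ℂ)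
        + ((-α / (α ^ 2 + β1 ^ 2) + α / (α ^ 2 + β2 ^ 2)
            + α ^ 2 - β2 ^ 2 - α ^ 2 + β1 ^ 2 : ℝ) : ℂ) * (y : ℂ))
    (tau : ℂ → ℝ → ℝ → ℂ)
    (htau : ∀ (n : ℂ) (t y : ℝ), tau n t y
      = Complex.exp (2 * ζ1 n t y) / (2 * (β1 : ℂ))
        + Complex.exp (2 * ζ2 n t y) / (2 * (β2 : ℂ))
        + 2 * ((β1 : ℂ) + (β2 : ℂ)) * Complex.exp (ζ1 n t y + ζ2 n t y)
            * Complex.cos (ζ3 n t y) / (((β1 + β2) ^ 2 + (α - α) ^ 2 : ℝ) : ℂ)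
        + 2 * ((α - α : ℝ) : ℂ) * Complex.exp (ζ1 n t y + ζ2 n t y)
            * Complex.sin (ζ3 n t y) / (((β1 + β2) ^ 2 + (α - α) ^ 2 : ℝ) : ℂ))
    (T : ℝ) (hT : T = 2 * Real.pi / |κ3|) :
    (∀ (n : ℂ) (t y : ℝ), tau n t (y + T)
      = ((Real.exp (2 * κ * T) : ℝ) : ℂ) * tau n t y)
    ∧ (∀ (n : ℂ) (t y : ℝ),
        tau (n + Complex.I) t (y + T) * tau (n - Complex.I) t (y + T)
            / (tau n t (y + T)) ^ 2
          = tau (n + Complex.I) t y * tau (n - Complex.I) t y / (tau n t y) ^ 2) := by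
  have shift1 : ∀ (n : ℂ) (t y : ℝ), ζ1 n t (y + T) = ζ1 n t y + κ * T := by
    intro n t y
    rw [hζ1, hζ1, ← hκ1]
    push_cast
    ring
  have shift2 : ∀ (n : ℂ) (t y : ℝ), ζ2 n t (y + T) = ζ2 n t y + κ * T := by
    intro n t y
    rw [hζ2, hζ2, ← hκ2]
    push_cast
    ring
  have shift3 : ∀ (n : ℂ) (t y : ℝ), ζ3 n t (y + T) = ζ3 n t y + ((κ3 * T : ℝ) : ℂ) := by
    intro n t y
    rw [hζ3, hζ3, hκ3]
    push_cast
    ring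
  have cos_shift : ∀ (n : ℂ) (t y : ℝ),
      Complex.cos (ζ3 n t (y + T)) = Complex.cos (ζ3 n t y) := by
    intro n t y
    rw [shift3]
    rcases abs_choice κ3 with h | h
    · have hκT : κ3 * T = 2 * Real.pi := by
        rw [hT, h]
        field_simp
      rw [hκT]
      push_cast
      exact Complex.cos_add_two_pi _
    · have hκT : κ3 * T = -(2 * Real.pi) := by
        rw [hT, h]
        field_simp
      rw [hκT]
      push_cast
      rw [← sub_eq_add_neg]
      exact Complex.cos_sub_two_pi _
  have tau_shift : ∀ (n : ℂ) (t y : ℝ), tau n t (y + T)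
      = ((Real.exp (2 * κ * T) : ℝ) : ℂ) * tau n t y := by
    intro n t y
    have exp_shift : ∀ z w : ℂ, w = z + 2 * κ * T →
        Complex.exp w = ((Real.exp (2 * κ * T) : ℝ) : ℂ) * Complex.exp z := by
      rintro z w rfl
      rw [Complex.exp_add]
      push_cast
      ring
    rw [htau, htau, cos_shift, shift1, shift2,
      exp_shift (2 * ζ1 n t y) (2 * (ζ1 n t y + κ * T)) (by ring),
      exp_shift (2 * ζ2 n t y) (2 * (ζ2 n t y + κ * T)) (by ring),
      exp_shift (ζ1 n t y + ζ2 n t y) (ζ1 n t y + κ * T + (ζ2 n t y + κ * T)) (by ring),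
      sub_self, Complex.ofReal_zero]
    ring
  refine ⟨tau_shift, fun n t y => ?_⟩
  have hE : ((Real.exp (2 * κ * T) : ℝ) : ℂ) ^ 2 ≠ 0 :=
    pow_ne_zero 2 (Complex.ofReal_ne_zero.mpr (Real.exp_ne_zero _))
  rw [tau_shift, tau_shift, tau_shift, mul_mul_mul_comm, ← sq, mul_pow,
    mul_div_mul_left _ _ hE]
end
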